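/- arXiv:1705.10232 — 3 statements merged into one kernel-verified Lean document; each statement's English description precedes it below -/
import Mathlib

section
/- For every r ∈ ℝ one has |r·φ_n'(r)| ≤ p·φ_n(r). -/
noncomputable def phi (p : ℝ) (n : ℕ) (r : ℝ) : ℝ :=
  if |r| < n then |r| ^ p
  else (n : ℝ) ^ (p - 2) * (p * (p - 1) / 2) * (|r| - n) ^ 2
        + p * (n : ℝ) ^ (p - 1) * (|r| - n) + (n : ℝ) ^ p

theorem phi_neg (p : ℝ) (n : ℕ) (r : ℝ) : phi p n (-r) = phi p n r := by
  simp only [phi, abs_neg]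

theorem phi_eq_rpow {p : ℝ} {n : ℕ} {r : ℝ} (h₀ : 0 ≤ r) (h : r < n) :
    phi p n r = r ^ p := by
  rw [phi, abs_of_nonneg h₀, if_pos h]

theorem phi_eq_quadratic {p : ℝ} {n : ℕ} {r : ℝ} (h : (n : ℝ) ≤ r) :
    phi p n r = (n : ℝ) ^ (p - 2) * (p * (p - 1) / 2) * (r - n) ^ 2
      + p * (n : ℝ) ^ (p - 1) * (r - n) + (n : ℝ) ^ p := by
  rw [phi, abs_of_nonneg (n.cast_nonneg.trans h), if_neg h.not_gt]

theorem hasDerivAt_phi_of_lt {p : ℝ} {n : ℕ} {r : ℝ} (h₀ : 0 < r) (h : r < n) :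
    HasDerivAt (phi p n) (p * r ^ (p - 1)) r := by
  refine (Real.hasDerivAt_rpow_const (Or.inl h₀.ne')).congr_of_eventuallyEq ?_
  filter_upwards [Ioo_mem_nhds h₀ h] with x hx
  exact phi_eq_rpow hx.1.le hx.2

theorem hasDerivWithinAt_phi_of_le {p : ℝ} {n : ℕ} {r : ℝ} (h : (n : ℝ) ≤ r) :
    HasDerivWithinAt (phi p n)
      ((n : ℝ) ^ (p - 2) * (p * (p - 1)) * (r - n) + p * (n : ℝ) ^ (p - 1))
      (Set.Ici r) r := by
  have hlin : HasDerivAt (fun x : ℝ => x - n) 1 r := (hasDerivAt_id r).sub_const _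
  have hquad := (((hlin.pow 2).const_mul ((n : ℝ) ^ (p - 2) * (p * (p - 1) / 2))).add
    (hlin.const_mul (p * (n : ℝ) ^ (p - 1)))).add_const ((n : ℝ) ^ p)
  refine (hquad.hasDerivWithinAt.congr (fun x hx => phi_eq_quadratic (h.trans hx))
    (phi_eq_quadratic h)).congr_deriv ?_
  norm_num
  ring

theorem phi_nonneg {p : ℝ} (hp : 1 ≤ p) (n : ℕ) (r : ℝ) : 0 ≤ phi p n r := by
  have hp' : 0 ≤ p - 1 := by linarith
  rw [phi]
  split_ifs with h
  · positivity
  · have : 0 ≤ |r| - n := by linarith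
    positivity

theorem phi_mul_deriv_bound_of_pos {p : ℝ} (hp : 2 ≤ p) {n : ℕ} (hn : 1 ≤ n) {r : ℝ}
    (hr : 0 < r) : |r * deriv (phi p n) r| ≤ p * phi p n r := by
  have hp₁ : 0 ≤ p - 1 := by linarith
  rcases lt_or_ge r (n : ℝ) with h | h
  · rw [(hasDerivAt_phi_of_lt hr h).deriv, phi_eq_rpow hr.le h, abs_of_nonneg (by positivity),
      Real.rpow_sub_one hr.ne']
    apply le_of_eq
    field_simp
  by_cases hd : DifferentiableAt ℝ (phi p n) r
  · have hderiv := (uniqueDiffWithinAt_Ici r).eq_deriv _ hd.hasDerivAt.hasDerivWithinAt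
      (hasDerivWithinAt_phi_of_le h)
    have hN : (0 : ℝ) < n := by exact_mod_cast hn
    have h₁ : (n : ℝ) ^ (p - 1) = (n : ℝ) ^ (p - 2) * n := by
      rw [← Real.rpow_add_one hN.ne']
      ring_nf
    have h₂ : (n : ℝ) ^ p = (n : ℝ) ^ (p - 2) * n ^ 2 := by
      rw [← Real.rpow_natCast, ← Real.rpow_add hN]
      norm_num
    have ht : 0 ≤ r - n := by linarith
    rw [hderiv, phi_eq_quadratic h, abs_of_nonneg (by positivity), h₁, h₂]
    have key : 0 ≤ (n : ℝ) ^ (p - 2) * (p * (p - 1) * (p - 2) / 2 * (r - n) ^ 2) := by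
      have : 0 ≤ p - 2 := by linarith
      positivity
    linarith
  · rw [deriv_zero_of_not_differentiableAt hd, mul_zero, abs_zero]
    exact mul_nonneg (by linarith) (phi_nonneg (by linarith) n r)

theorem phi_mul_deriv_bound (p : ℝ) (hp : 2 ≤ p) (n : ℕ) (hn : 1 ≤ n) :
    ∀ r : ℝ, |r * deriv (phi p n) r| ≤ p * phi p n r := by
  intro r
  rcases lt_trichotomy r 0 with hr | rfl | hr
  · have h := phi_mul_deriv_bound_of_pos hp hn (neg_pos.2 hr)
    have hodd : deriv (phi p n) r = -deriv (phi p n) (-r) := by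
      rw [← deriv_comp_neg]
      simp only [phi_neg]
    rw [phi_neg] at h
    rwa [hodd, mul_neg, ← neg_mul]
  · rw [zero_mul, abs_zero]
    exact mul_nonneg (by linarith) (phi_nonneg (by linarith) n 0)
  · exact phi_mul_deriv_bound_of_pos hp hn hr
end

section
/- For every r ∈ ℝ one has (φ_n'(r))² ≤ 4p·φ_n''(r)·φ_n(r). -/
open Filter Topology in
theorem HasDerivAt.ite_lt {f g : ℝ → ℝ} {f' g' a x : ℝ} (hf : HasDerivAt f f' x)
    (hg : HasDerivAt g g' x) (h : f a = g a) (h' : x = a → f' = g') :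
    HasDerivAt (fun y => if y < a then f y else g y) (if x < a then f' else g') x := by
  rcases lt_trichotomy x a with hx | hx | hx
  · rw [if_pos hx]
    refine hf.congr_of_eventuallyEq ?_
    filter_upwards [Iio_mem_nhds hx] with y hy
    exact if_pos hy
  · subst hx
    rw [if_neg (lt_irrefl x)]
    rw [h' rfl] at hf
    have hl : HasDerivWithinAt (fun y => if y < x then f y else g y) g' (Set.Iic x) x := by
      refine hf.hasDerivWithinAt.congr (fun y hy => ?_) ?_
      · rcases (Set.mem_Iic.1 hy).lt_or_eq with hy | rfl
        · exact if_pos hy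
        · simp [h]
      · simp [h]
    have hr : HasDerivWithinAt (fun y => if y < x then f y else g y) g' (Set.Ici x) x := by
      refine hg.hasDerivWithinAt.congr (fun y hy => ?_) ?_
      · exact if_neg (not_lt.2 hy)
      · simp
    have := hl.union hr
    rwa [Set.Iic_union_Ici, hasDerivWithinAt_univ] at this
  · rw [if_neg hx.not_gt]
    refine hg.congr_of_eventuallyEq ?_
    filter_upwards [Ioi_mem_nhds hx] with y hy
    exact if_neg (not_lt.2 (le_of_lt hy))

theorem hasDerivAt_phi_of_pos (p : ℝ) (n : ℕ) {r : ℝ} (hr : 0 < r) :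
    HasDerivAt (phi p n) (if r < n then p * r ^ (p - 1)
      else (n : ℝ) ^ (p - 2) * (p * (p - 1)) * (r - n) + p * (n : ℝ) ^ (p - 1)) r := by
  have hf : HasDerivAt (fun y : ℝ => y ^ p) (p * r ^ (p - 1)) r :=
    Real.hasDerivAt_rpow_const (Or.inl hr.ne')
  have hs : HasDerivAt (fun y : ℝ => y - n) 1 r := (hasDerivAt_id r).sub_const _
  have hg : HasDerivAt (fun y : ℝ => (n : ℝ) ^ (p - 2) * (p * (p - 1) / 2) * (y - n) ^ 2
        + p * (n : ℝ) ^ (p - 1) * (y - n) + (n : ℝ) ^ p)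
      ((n : ℝ) ^ (p - 2) * (p * (p - 1)) * (r - n) + p * (n : ℝ) ^ (p - 1)) r := by
    refine HasDerivAt.congr_deriv ((((hs.pow 2).const_mul ((n : ℝ) ^ (p - 2) * (p * (p - 1) / 2))).add
      (hs.const_mul (p * (n : ℝ) ^ (p - 1)))).add_const ((n : ℝ) ^ p)) ?_
    push_cast
    ring
  refine (hf.ite_lt hg (a := n) (by simp) (by rintro rfl; simp)).congr_of_eventuallyEq ?_
  filter_upwards [Ioi_mem_nhds hr] with y hy
  simp only [phi, abs_of_pos (Set.mem_Ioi.1 hy)]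

theorem hasDerivAt_deriv_phi_of_pos (p : ℝ) (n : ℕ) {r : ℝ} (hr : 0 < r) :
    HasDerivAt (deriv (phi p n)) (if r < n then p * ((p - 1) * r ^ (p - 2))
      else (n : ℝ) ^ (p - 2) * (p * (p - 1))) r := by
  have hf : HasDerivAt (fun y : ℝ => p * y ^ (p - 1)) (p * ((p - 1) * r ^ (p - 2))) r := by
    refine ((Real.hasDerivAt_rpow_const (p := p - 1) (Or.inl hr.ne')).const_mul p).congr_deriv ?_
    rw [show p - 1 - 1 = p - 2 by ring]
  have hs : HasDerivAt (fun y : ℝ => y - n) 1 r := (hasDerivAt_id r).sub_const _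
  have hg : HasDerivAt (fun y : ℝ => (n : ℝ) ^ (p - 2) * (p * (p - 1)) * (y - n)
      + p * (n : ℝ) ^ (p - 1)) ((n : ℝ) ^ (p - 2) * (p * (p - 1))) r := by
    refine HasDerivAt.congr_deriv ((hs.const_mul ((n : ℝ) ^ (p - 2) * (p * (p - 1)))).add_const
      (p * (n : ℝ) ^ (p - 1))) ?_
    ring
  refine (hf.ite_lt hg (a := n) (by simp) (by rintro rfl; ring)).congr_of_eventuallyEq ?_
  filter_upwards [Ioi_mem_nhds hr] with y hy
  exact (hasDerivAt_phi_of_pos p n hy).deriv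

theorem deriv_phi_neg (p : ℝ) (n : ℕ) (r : ℝ) :
    deriv (phi p n) (-r) = -deriv (phi p n) r := by
  have h := deriv_comp_neg (phi p n) r
  simp only [phi_neg] at h
  linarith

theorem deriv_deriv_phi_neg (p : ℝ) (n : ℕ) (r : ℝ) :
    deriv (deriv (phi p n)) (-r) = deriv (deriv (phi p n)) r := by
  have h := deriv_comp_neg (deriv (phi p n)) r
  simp only [deriv_phi_neg, deriv.fun_neg] at h
  linarith

theorem phi_deriv_sq_bound_of_pos (p : ℝ) (hp : 2 ≤ p) (n : ℕ) (hn : 1 ≤ n) {r : ℝ}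
    (hr : 0 < r) :
    (deriv (phi p n) r) ^ 2 ≤ 4 * p * deriv (deriv (phi p n)) r * phi p n r := by
  rw [(hasDerivAt_phi_of_pos p n hr).deriv, (hasDerivAt_deriv_phi_of_pos p n hr).deriv]
  simp only [phi, abs_of_pos hr]
  have key : ∀ x : ℝ, 0 < x → x ^ (p - 1) = x ^ (p - 2) * x ∧ x ^ p = x ^ (p - 2) * x ^ 2 := by
    intro x hx
    constructor
    · rw [← Real.rpow_add_one hx.ne']
      congr 1
      ring
    · rw [← Real.rpow_natCast x 2, ← Real.rpow_add hx]
      congr 1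
      push_cast
      ring
  split_ifs with h
  · obtain ⟨h1, h2⟩ := key r hr
    rw [h1, h2]
    set A := r ^ (p - 2)
    have h3 : 0 ≤ (p * A * r) ^ 2 * (4 * (p - 1) - 1) :=
      mul_nonneg (sq_nonneg _) (by linarith)
    linarith
  · have hn' : (0 : ℝ) < n := by exact_mod_cast hn
    obtain ⟨h1, h2⟩ := key n hn'
    rw [h1, h2]
    set A := (n : ℝ) ^ (p - 2)
    obtain ⟨s, hs, rfl⟩ : ∃ s : ℝ, 0 ≤ s ∧ r = n + s := ⟨r - n, by linarith, by ring⟩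
    obtain ⟨q, hq, rfl⟩ : ∃ q : ℝ, 0 ≤ q ∧ p = 2 + q := ⟨p - 2, by linarith, by ring⟩
    rw [← sub_nonneg]
    have h3 : 0 ≤ (A * (2 + q)) ^ 2 * ((q + 1) ^ 2 * (2 * (2 + q) - 1) * s ^ 2
        + (q + 1) * (4 * (2 + q) - 2) * (n * s) + (4 * (q + 1) - 1) * n ^ 2) := by
      have h4 : 0 ≤ 2 * (2 + q) - 1 := by linarith
      have h5 : 0 ≤ 4 * (2 + q) - 2 := by linarith
      have h6 : 0 ≤ 4 * (q + 1) - 1 := by linarith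
      positivity
    refine h3.trans_eq ?_
    ring

theorem phi_deriv_sq_bound (p : ℝ) (hp : 2 ≤ p) (n : ℕ) (hn : 1 ≤ n) :
    ∀ r : ℝ, (deriv (phi p n) r) ^ 2 ≤ 4 * p * deriv (deriv (phi p n)) r * phi p n r := by
  intro r
  rcases lt_trichotomy r 0 with hr | rfl | hr
  · have h := phi_deriv_sq_bound_of_pos p hp n hn (neg_pos.2 hr)
    rwa [deriv_phi_neg, deriv_deriv_phi_neg, phi_neg, neg_sq] at h
  · have h0 : phi p n 0 = 0 := by
      have hn' : (0 : ℝ) < n := by exact_mod_cast hn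
      simp [phi, hn', Real.zero_rpow (by linarith : p ≠ 0)]
    have h1 := deriv_phi_neg p n 0
    rw [neg_zero] at h1
    have h2 : deriv (phi p n) 0 = 0 := by linarith
    simp [h0, h2]
  · exact phi_deriv_sq_bound_of_pos p hp n hn hr
end

section
/- There exists a constant K' depending only on K, d and κ with the following property: whenever a = (a^{ij}) is a real d×d matrix, b ∈ ℝ^d, c ∈ ℝ, σ = (σ^{ik})_{1≤i≤d, k∈ℕ} and μ = (μ^k)_{k∈ℕ} are real families satisfying |b^i| ≤ K and |c| ≤ K, ∑_{i=1}^d ∑_{k∈ℕ} (σ^{ik})² + ∑_{k∈ℕ} (μ^k)² ≤ K, and the parabolicity condition ∑_{i,j=1}^d (a^{ij} − ½ ∑_{k∈ℕ} σ^{ik} σ^{jk}) ξ_i ξ_j ≥ κ|ξ|² for all ξ ∈ ℝ^d, then for all ξ ∈ ℝ^d and r ∈ ℝ: −2 ∑_{i,j=1}^d a^{ij} ξ_i ξ_j + 2r ∑_{i=1}^d b^i ξ_i + 2c·r² + ∑_{k∈ℕ} (∑_{i=1}^d σ^{ik} ξ_i + μ^k r)² ≤ −κ|ξ|² + K'·r².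 -/
theorem summable_mul_of_summable_sq {ι : Type*} {f g : ι → ℝ}
    (hf : Summable fun k => f k ^ 2) (hg : Summable fun k => g k ^ 2) :
    Summable fun k => f k * g k := by
  refine Summable.of_norm_bounded (hf.add hg) fun k => ?_
  rw [Real.norm_eq_abs, abs_le]
  constructor <;> nlinarith [sq_nonneg (f k + g k), sq_nonneg (f k - g k),
    sq_nonneg (f k), sq_nonneg (g k)]

theorem abs_tsum_mul_le_of_summable_sq {ι : Type*} {f g : ι → ℝ}
    (hf : Summable fun k => f k ^ 2) (hg : Summable fun k => g k ^ 2) :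
    |∑' k, f k * g k| ≤ ∑' k, f k ^ 2 + ∑' k, g k ^ 2 := by
  have hfg := summable_mul_of_summable_sq hf hg
  rw [← hf.tsum_add hg, abs_le, ← tsum_neg]
  constructor
  · refine (hf.add hg).neg.tsum_le_tsum (fun k => ?_) hfg
    nlinarith [sq_nonneg (f k + g k), sq_nonneg (f k), sq_nonneg (g k)]
  · refine hfg.tsum_le_tsum (fun k => ?_) (hf.add hg)
    nlinarith [sq_nonneg (f k - g k), sq_nonneg (f k), sq_nonneg (g k)]

theorem tsum_sq_linear_combination {ι κ : Type*} [Fintype ι] {σ : ι → κ → ℝ} {μ : κ → ℝ}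
    (hσ : ∀ i, Summable fun k => σ i k ^ 2) (hμ : Summable fun k => μ k ^ 2)
    (ξ : ι → ℝ) (r : ℝ) :
    ∑' k, (∑ i, σ i k * ξ i + μ k * r) ^ 2 =
      ∑ i, ∑ j, (∑' k, σ i k * σ j k) * ξ i * ξ j +
        2 * r * ∑ i, (∑' k, σ i k * μ k) * ξ i + (∑' k, μ k ^ 2) * r ^ 2 := by
  have hquad : HasSum (fun k => ∑ i, ∑ j, σ i k * σ j k * ξ i * ξ j)
      (∑ i, ∑ j, (∑' k, σ i k * σ j k) * ξ i * ξ j) :=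
    hasSum_sum fun i _ => hasSum_sum fun j _ =>
      ((summable_mul_of_summable_sq (hσ i) (hσ j)).hasSum.mul_right _).mul_right _
  have hcross : HasSum (fun k => ∑ i, σ i k * μ k * ξ i) (∑ i, (∑' k, σ i k * μ k) * ξ i) :=
    hasSum_sum fun i _ => (summable_mul_of_summable_sq (hσ i) hμ).hasSum.mul_right _
  refine HasSum.tsum_eq ?_
  convert (hquad.add (hcross.mul_left (2 * r))).add (hμ.hasSum.mul_right (r ^ 2)) using 2 with k
  have h₁ : ∑ i, ∑ j, σ i k * σ j k * ξ i * ξ j = (∑ i, σ i k * ξ i) ^ 2 := by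
    rw [sq, Finset.sum_mul_sum]
    exact Finset.sum_congr rfl fun i _ => Finset.sum_congr rfl fun j _ => by ring
  have h₂ : ∑ i, σ i k * μ k * ξ i = μ k * ∑ i, σ i k * ξ i := by
    rw [Finset.mul_sum]
    exact Finset.sum_congr rfl fun i _ => by ring
  rw [h₁, h₂]
  ring

theorem two_mul_mul_sum_le {ι : Type*} [Fintype ι] {κ B : ℝ} (hκ : 0 < κ) {v : ι → ℝ}
    (hv : ∀ i, |v i| ≤ B) (ξ : ι → ℝ) (r : ℝ) :
    2 * r * ∑ i, v i * ξ i ≤ κ * ∑ i, ξ i ^ 2 + Fintype.card ι * (B ^ 2 / κ) * r ^ 2 := by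
  have hterm (i : ι) : 2 * r * (v i * ξ i) ≤ κ * ξ i ^ 2 + B ^ 2 / κ * r ^ 2 := by
    have hsq : v i ^ 2 / κ * r ^ 2 ≤ B ^ 2 / κ * r ^ 2 := by
      have := sq_le_sq' (abs_le.mp (hv i)).1 (abs_le.mp (hv i)).2
      gcongr
    have hyoung : 0 ≤ κ * ξ i ^ 2 + v i ^ 2 / κ * r ^ 2 - 2 * r * (v i * ξ i) := by
      have : κ * ξ i ^ 2 + v i ^ 2 / κ * r ^ 2 - 2 * r * (v i * ξ i) =
          (κ * ξ i - v i * r) ^ 2 / κ := by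
        field_simp
        ring
      rw [this]
      positivity
    linarith
  calc 2 * r * ∑ i, v i * ξ i = ∑ i, 2 * r * (v i * ξ i) := Finset.mul_sum ..
    _ ≤ ∑ i, (κ * ξ i ^ 2 + B ^ 2 / κ * r ^ 2) := Finset.sum_le_sum fun i _ => hterm i
    _ = κ * ∑ i, ξ i ^ 2 + Fintype.card ι * (B ^ 2 / κ) * r ^ 2 := by
      simp only [Finset.sum_add_distrib, ← Finset.mul_sum, Finset.sum_const, Finset.card_univ,
        nsmul_eq_mul]
      ring


theorem pointwise_coercivity (d : ℕ) (K κ : ℝ) (hK : 0 < K) (hκ : 0 < κ) :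
    ∃ K' : ℝ, ∀ (a : Fin d → Fin d → ℝ) (b : Fin d → ℝ) (c : ℝ)
      (σ : Fin d → ℕ → ℝ) (μ : ℕ → ℝ),
      (∀ i, |b i| ≤ K) → |c| ≤ K →
      (∀ i, Summable (fun k => σ i k ^ 2)) → Summable (fun k => μ k ^ 2) →
      (∑ i, ∑' k, σ i k ^ 2) + (∑' k, μ k ^ 2) ≤ K →
      (∀ ξ : Fin d → ℝ,
        κ * ∑ i, ξ i ^ 2 ≤
          ∑ i, ∑ j, (a i j - (1 / 2) * ∑' k, σ i k * σ j k) * ξ i * ξ j) →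
      ∀ (ξ : Fin d → ℝ) (r : ℝ),
        -2 * (∑ i, ∑ j, a i j * ξ i * ξ j) + 2 * r * (∑ i, b i * ξ i) + 2 * c * r ^ 2 +
            (∑' k, (∑ i, σ i k * ξ i + μ k * r) ^ 2) ≤
          -κ * ∑ i, ξ i ^ 2 + K' * r ^ 2 := by
  refine ⟨3 * K + d * ((2 * K) ^ 2 / κ), ?_⟩
  intro a b c σ μ hb hc hσ hμ hbound hpar ξ r
  have hσ0 (i : Fin d) : 0 ≤ ∑' k, σ i k ^ 2 := tsum_nonneg fun k => sq_nonneg _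
  have hμK : ∑' k, μ k ^ 2 ≤ K := by
    linarith [Finset.sum_nonneg fun i (_ : i ∈ Finset.univ) => hσ0 i]
  have hdrift (i : Fin d) : |b i + ∑' k, σ i k * μ k| ≤ 2 * K := by
    have hcross := abs_tsum_mul_le_of_summable_sq (hσ i) hμ
    have hsingle := Finset.single_le_sum (fun j _ => hσ0 j) (Finset.mem_univ i)
    linarith [abs_add_le (b i) (∑' k, σ i k * μ k), hb i]
  have hyoung := two_mul_mul_sum_le hκ hdrift ξ r
  rw [Fintype.card_fin] at hyoung
  simp only [add_mul, Finset.sum_add_distrib, mul_add] at hyoung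
  have hparξ : κ * ∑ i, ξ i ^ 2 ≤ (∑ i, ∑ j, a i j * ξ i * ξ j) -
      (1 / 2) * ∑ i, ∑ j, (∑' k, σ i k * σ j k) * ξ i * ξ j := by
    refine (hpar ξ).trans_eq ?_
    simp only [Finset.mul_sum, ← Finset.sum_sub_distrib]
    exact Finset.sum_congr rfl fun i _ => Finset.sum_congr rfl fun j _ => by ring
  have hcr : c * r ^ 2 ≤ K * r ^ 2 := by
    gcongr
    exact (abs_le.mp hc).2
  have hμr : (∑' k, μ k ^ 2) * r ^ 2 ≤ K * r ^ 2 := by gcongr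
  rw [tsum_sq_linear_combination hσ hμ]
  linarith
end
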